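/- arXiv:2201.01049 — 3 statements merged into one kernel-verified Lean document; each statement's English description precedes it below -/
import Mathlib

section
/- The determinantal hypersurface arrangement A in P^14 defined by F = f₁·f₂·f₃·f₅·f₁₀ is not free; that is, the module of Jacobian syzygies AR(F) is not a free S-module. -/
open MvPolynomial

noncomputable section

/-- The polynomial ring `S = ℂ[x_{i,j} : 1 ≤ i ≤ 3, 1 ≤ j ≤ 5]`,
the entries of the generic `3 × 5` matrix. -/
abbrev S : Type := MvPolynomial (Fin 3 × Fin 5) ℂ

/-- The linear map `(a_v)_v ↦ ∑ v, a_v · ∂F/∂x_v`. -/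
def jacMap {R : Type} [CommRing R] {σ : Type} [Fintype σ] [DecidableEq σ]
    (F : MvPolynomial σ R) : (σ → MvPolynomial σ R) →ₗ[MvPolynomial σ R] MvPolynomial σ R where
  toFun a := ∑ v, a v * pderiv v F
  map_add' a b := by simp [add_mul, Finset.sum_add_distrib]
  map_smul' c a := by simp [Finset.mul_sum, smul_eq_mul, mul_assoc]

/-- The module of Jacobian syzygies `AR(F)`. -/
def AR {R : Type} [CommRing R] {σ : Type} [Fintype σ] [DecidableEq σ]
    (F : MvPolynomial σ R) : Submodule (MvPolynomial σ R) (σ → MvPolynomial σ R) :=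
  LinearMap.ker (jacMap F)

/-- The `3`-minor `Δ_{abc}` of the generic `3 × 5` matrix on columns `a, b, c`. -/
def Δ (a b c : Fin 5) : S :=
  Matrix.det (Matrix.of fun i k : Fin 3 => X (i, ![a, b, c] k))

/-- The ten minors `f₁, …, f₁₀` (zero-indexed: `f 0 = f₁`, …, `f 9 = f₁₀`). -/
def f : Fin 10 → S :=
  ![Δ 0 1 2, Δ 0 1 3, Δ 0 2 3, Δ 1 2 3, Δ 0 1 4,
    Δ 0 2 4, Δ 1 2 4, Δ 0 3 4, Δ 1 3 4, Δ 2 3 4]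

theorem jacMap_mul {R σ : Type} [CommRing R] [Fintype σ] [DecidableEq σ]
    (g h : MvPolynomial σ R) (a : σ → MvPolynomial σ R) :
    jacMap (g * h) a = jacMap g a * h + g * jacMap h a := by
  simp only [jacMap, LinearMap.coe_mk, AddHom.coe_mk, Derivation.leibniz, smul_eq_mul,
    Finset.sum_mul, Finset.mul_sum, ← Finset.sum_add_distrib]
  exact Finset.sum_congr rfl fun v _ => by ring

/-- A syzygy of `g * h` is tangent to `g = 0` along any family of points of `g = 0` that is not
contained in `h = 0`. -/
theorem map_jacMap_eq_zero {σ : Type} [Fintype σ] [DecidableEq σ] {K B : Type} [CommRing K]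
    [CommRing B] [IsDomain B] (φ : MvPolynomial σ K →+* B) {g h : MvPolynomial σ K}
    {a : σ → MvPolynomial σ K} (ha : a ∈ AR (g * h)) (hg : φ g = 0) (hh : φ h ≠ 0) :
    φ (jacMap g a) = 0 := by
  have h0 : jacMap g a * h + g * jacMap h a = 0 := by rw [← jacMap_mul]; exact ha
  have h1 := congrArg φ h0
  rw [map_add, map_mul, map_mul, hg, zero_mul, add_zero, map_zero] at h1
  exact (mul_eq_zero.mp h1).resolve_right hh

theorem derivative_aeval {σ : Type} [Fintype σ] [DecidableEq σ] (q : σ → Polynomial ℂ)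
    (a : MvPolynomial σ ℂ) :
    Polynomial.derivative (aeval q a) =
      ∑ v, aeval q (pderiv v a) * Polynomial.derivative (q v) := by
  induction a using MvPolynomial.induction_on with
  | C r => simp [Polynomial.algebraMap_eq]
  | add f g hf hg => simp [hf, hg, add_mul, Finset.sum_add_distrib]
  | mul_X f i hf =>
    have hterm (v : σ) : aeval q (pderiv v (f * X i)) * Polynomial.derivative (q v) =
        aeval q (pderiv v f) * Polynomial.derivative (q v) * q i
          + if v = i then aeval q f * Polynomial.derivative (q v) else 0 := by
      rw [pderiv_mul, pderiv_X, map_add, map_mul, map_mul, aeval_X]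
      rcases eq_or_ne v i with rfl | hv
      · rw [Pi.single_eq_same, map_one, if_pos rfl]
        ring
      · rw [Pi.single_eq_of_ne hv.symm, map_zero, if_neg hv]
        ring
    simp_rw [hterm]
    rw [Finset.sum_add_distrib, ← Finset.sum_mul, ← hf, Finset.sum_ite_eq' Finset.univ i,
      if_pos (Finset.mem_univ i), map_mul, aeval_X, Polynomial.derivative_mul]

theorem eval_zero_aeval {σ : Type} (q : σ → Polynomial ℂ) (a : MvPolynomial σ ℂ) :
    Polynomial.eval 0 (aeval q a) = eval (fun v => Polynomial.eval 0 (q v)) a := by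
  induction a using MvPolynomial.induction_on with
  | C r => simp
  | add f g hf hg => simp [hf, hg]
  | mul_X f i hf => simp [hf]

theorem Δ_eq (i j k : Fin 5) : Δ i j k =
    X (0, i) * (X (1, j) * X (2, k) - X (1, k) * X (2, j))
    - X (0, j) * (X (1, i) * X (2, k) - X (1, k) * X (2, i))
    + X (0, k) * (X (1, i) * X (2, j) - X (1, j) * X (2, i)) := by
  simp [Δ, Matrix.det_fin_three]
  ring

/-- The determinant of columns `i, j, k` of the matrix with rows `r, s, t`. -/
def rowMinor {B : Type} [CommRing B] (r s t : Fin 5 → B) (i j k : Fin 5) : B :=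
  r i * (s j * t k - s k * t j) - r j * (s i * t k - s k * t i) + r k * (s i * t j - s j * t i)

theorem jacMap_X {σ : Type} [Fintype σ] [DecidableEq σ] (v : σ) (a : σ → MvPolynomial σ ℂ) :
    jacMap (X v) a = a v := by
  simp [jacMap, pderiv_X, Pi.single_apply]

theorem jacMap_add {σ : Type} [Fintype σ] [DecidableEq σ] (g h : MvPolynomial σ ℂ)
    (a : σ → MvPolynomial σ ℂ) : jacMap (g + h) a = jacMap g a + jacMap h a := by
  simp [jacMap, mul_add, Finset.sum_add_distrib]

theorem jacMap_sub {σ : Type} [Fintype σ] [DecidableEq σ] (g h : MvPolynomial σ ℂ)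
    (a : σ → MvPolynomial σ ℂ) : jacMap (g - h) a = jacMap g a - jacMap h a := by
  simp [jacMap, mul_sub, Finset.sum_sub_distrib]

theorem jacMap_Δ (i j k : Fin 5) (a : Fin 3 × Fin 5 → S) : jacMap (Δ i j k) a =
    rowMinor (fun l => a (0, l)) (fun l => X (1, l)) (fun l => X (2, l)) i j k
    + rowMinor (fun l => X (0, l)) (fun l => a (1, l)) (fun l => X (2, l)) i j k
    + rowMinor (fun l => X (0, l)) (fun l => X (1, l)) (fun l => a (2, l)) i j k := by
  simp only [Δ_eq, jacMap_add, jacMap_sub, jacMap_mul, jacMap_X, rowMinor]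
  ring

/-- First row of the base point, five columns spanning a plane. -/
def row₀ : Fin 5 → ℂ := ![1, 0, 1, 1, 1]

/-- Second row of the base point. -/
def row₁ : Fin 5 → ℂ := ![0, 1, 1, -1, 2]

/-- The base point: a `3 × 5` matrix with last row zero. -/
def base (v : Fin 3 × Fin 5) : ℂ := ![row₀ v.2, row₁ v.2, 0] v.1

/-- The line through the base point in which only the last row moves, with velocity `w`. -/
def line (w : Fin 5 → ℂ) (v : Fin 3 × Fin 5) : Polynomial ℂ :=
  ![Polynomial.C (row₀ v.2), Polynomial.C (row₁ v.2), Polynomial.C (w v.2) * Polynomial.X] v.1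

theorem eval_zero_line (w : Fin 5 → ℂ) : (fun v => Polynomial.eval 0 (line w v)) = base := by
  funext ⟨i, j⟩
  fin_cases i <;> simp [line, base]

theorem aeval_line_Δ (w : Fin 5 → ℂ) (i j k : Fin 5) :
    aeval (line w) (Δ i j k) = Polynomial.C (rowMinor row₀ row₁ w i j k) * Polynomial.X := by
  simp only [Δ_eq, rowMinor, line, map_add, map_sub, map_mul, aeval_X, Matrix.cons_val]
  ring

theorem derivative_line (w : Fin 5 → ℂ) (a : S) :
    Polynomial.eval 0 (Polynomial.derivative (aeval (line w) a)) =
      ∑ l, w l * eval base (pderiv (2, l) a) := by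
  rw [derivative_aeval, Polynomial.eval_finsetSum, Fintype.sum_prod_type, Fin.sum_univ_three]
  simp only [Polynomial.eval_mul, eval_zero_aeval, eval_zero_line]
  simp [line, mul_comm (w _)]

/-- First-order tangency of a syzygy to the hypersurface `Δ i j k = 0` at the base point. -/
theorem tangency {i j k : Fin 5} {h : S} {a : Fin 3 × Fin 5 → S} (ha : a ∈ AR (Δ i j k * h))
    (w : Fin 5 → ℂ) (hw : rowMinor row₀ row₁ w i j k = 0) (hh : aeval (line w) h ≠ 0) :
    rowMinor (fun l => eval base (a (0, l))) row₁ w i j k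
    + rowMinor row₀ (fun l => eval base (a (1, l))) w i j k
    + rowMinor row₀ row₁ (fun m => ∑ l, w l * eval base (pderiv (2, l) (a (2, m)))) i j k = 0 := by
  have h0 := map_jacMap_eq_zero (aeval (line w)).toRingHom ha
    (by simp [aeval_line_Δ, hw]) hh
  have h1 := congrArg (fun p => Polynomial.eval 0 (Polynomial.derivative p)) h0
  simp only [← derivative_line]
  simp only [← eval_zero_line w, ← eval_zero_aeval]
  simp [jacMap_Δ, rowMinor, line] at h1
  simp only [rowMinor]
  linear_combination h1

/-- The variation, at the base point, of the cross ratio of the columns `0, 2, 3, 4` of the first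
two rows. -/
def crossRatioForm : (Fin 3 × Fin 5 → S) →ₗ[S] S where
  toFun a := 3 * a (0, 2) - a (0, 3) - 2 * a (0, 4)
    + 3 * a (1, 0) - 3 * a (1, 2) - a (1, 3) + a (1, 4)
  map_add' a b := by simp only [Pi.add_apply]; ring
  map_smul' c a := by simp only [Pi.smul_apply, smul_eq_mul, RingHom.id_apply]; ring

theorem eval_base_crossRatioForm {a : Fin 3 × Fin 5 → S}
    (ha : a ∈ AR (Δ 0 1 2 * Δ 0 1 3 * Δ 0 2 3 * Δ 0 1 4 * Δ 2 3 4)) :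
    eval base (crossRatioForm a) = 0 := by
  have m012 : a ∈ AR (Δ 0 1 2 * (Δ 0 1 3 * Δ 0 2 3 * Δ 0 1 4 * Δ 2 3 4)) := by
    convert ha using 2; ring
  have h1 := tangency m012 ![0, 0, 0, 12, 1] (by simp only [rowMinor, row₀, row₁, Matrix.cons_val]; norm_num)
    (by
      simp only [map_mul, aeval_line_Δ, ne_eq, mul_eq_zero, Polynomial.C_eq_zero,
        Polynomial.X_ne_zero, or_false, rowMinor, row₀, row₁, Matrix.cons_val]
      norm_num)
  have m013 : a ∈ AR (Δ 0 1 3 * (Δ 0 1 2 * Δ 0 2 3 * Δ 0 1 4 * Δ 2 3 4)) := by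
    convert ha using 2; ring
  have h2 := tangency m013 ![0, 0, -4, 0, 1] (by simp only [rowMinor, row₀, row₁, Matrix.cons_val]; norm_num)
    (by
      simp only [map_mul, aeval_line_Δ, ne_eq, mul_eq_zero, Polynomial.C_eq_zero,
        Polynomial.X_ne_zero, or_false, rowMinor, row₀, row₁, Matrix.cons_val]
      norm_num)
  have m023 : a ∈ AR (Δ 0 2 3 * (Δ 0 1 2 * Δ 0 1 3 * Δ 0 1 4 * Δ 2 3 4)) := by
    convert ha using 2; ring
  have h3 := tangency m023 ![0, 0, 3, -3, -1] (by simp only [rowMinor, row₀, row₁, Matrix.cons_val]; norm_num)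
    (by
      simp only [map_mul, aeval_line_Δ, ne_eq, mul_eq_zero, Polynomial.C_eq_zero,
        Polynomial.X_ne_zero, or_false, rowMinor, row₀, row₁, Matrix.cons_val]
      norm_num)
  have m014 : a ∈ AR (Δ 0 1 4 * (Δ 0 1 2 * Δ 0 1 3 * Δ 0 2 3 * Δ 2 3 4)) := by
    convert ha using 2; ring
  have h4 := tangency m014 ![0, 0, -3, -7, 0] (by simp only [rowMinor, row₀, row₁, Matrix.cons_val]; norm_num)
    (by
      simp only [map_mul, aeval_line_Δ, ne_eq, mul_eq_zero, Polynomial.C_eq_zero,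
        Polynomial.X_ne_zero, or_false, rowMinor, row₀, row₁, Matrix.cons_val]
      norm_num)
  have h5 := tangency m014 ![0, 0, 1, 1, 0] (by simp only [rowMinor, row₀, row₁, Matrix.cons_val]; norm_num)
    (by
      simp only [map_mul, aeval_line_Δ, ne_eq, mul_eq_zero, Polynomial.C_eq_zero,
        Polynomial.X_ne_zero, or_false, rowMinor, row₀, row₁, Matrix.cons_val]
      norm_num)
  have m234 : a ∈ AR (Δ 2 3 4 * (Δ 0 1 2 * Δ 0 1 3 * Δ 0 2 3 * Δ 0 1 4)) := by
    convert ha using 2; ring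
  have h6 := tangency m234 ![0, 0, 1, 1, 1] (by simp only [rowMinor, row₀, row₁, Matrix.cons_val]; norm_num)
    (by
      simp only [map_mul, aeval_line_Δ, ne_eq, mul_eq_zero, Polynomial.C_eq_zero,
        Polynomial.X_ne_zero, or_false, rowMinor, row₀, row₁, Matrix.cons_val]
      norm_num)
  have h7 := tangency m234 ![0, 0, -2, -4, -1] (by simp only [rowMinor, row₀, row₁, Matrix.cons_val]; norm_num)
    (by
      simp only [map_mul, aeval_line_Δ, ne_eq, mul_eq_zero, Polynomial.C_eq_zero,
        Polynomial.X_ne_zero, or_false, rowMinor, row₀, row₁, Matrix.cons_val]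
      norm_num)
  simp [rowMinor, row₀, row₁, Fin.sum_univ_five] at h1 h2 h3 h4 h5 h6 h7
  simp only [crossRatioForm, LinearMap.coe_mk, AddHom.coe_mk, map_add, map_sub, map_mul,
    map_ofNat]
  linear_combination (1 / 2) * (h1 + h2 + h3 + h4 + h5 + h6 + h7)

/-- The field moving the last column along `u` times column `2` plus `v` times column `3`,
corrected by `g` times the Euler field of the last row. -/
def columnField (u v g : S) (p : Fin 3 × Fin 5) : S :=
  (if p.2 = 4 then 5 * (u * X (p.1, 2) + v * X (p.1, 3)) else 0)
    - (if p.1 = 2 then g * X (2, p.2) else 0)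

theorem columnField_mem {u v g : S} (h : u * Δ 0 1 2 + v * Δ 0 1 3 = g * Δ 0 1 4) :
    columnField u v g ∈ AR (Δ 0 1 2 * Δ 0 1 3 * Δ 0 2 3 * Δ 0 1 4 * Δ 2 3 4) := by
  have h012 : jacMap (Δ 0 1 2) (columnField u v g) = -g * Δ 0 1 2 := by
    rw [jacMap_Δ]
    simp [rowMinor, columnField, Δ_eq]
    ring
  have h013 : jacMap (Δ 0 1 3) (columnField u v g) = -g * Δ 0 1 3 := by
    rw [jacMap_Δ]
    simp [rowMinor, columnField, Δ_eq]
    ring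
  have h023 : jacMap (Δ 0 2 3) (columnField u v g) = -g * Δ 0 2 3 := by
    rw [jacMap_Δ]
    simp [rowMinor, columnField, Δ_eq]
    ring
  have h014 : jacMap (Δ 0 1 4) (columnField u v g) =
      5 * (u * Δ 0 1 2 + v * Δ 0 1 3) - g * Δ 0 1 4 := by
    rw [jacMap_Δ]
    simp [rowMinor, columnField, Δ_eq]
    ring
  have h234 : jacMap (Δ 2 3 4) (columnField u v g) = -g * Δ 2 3 4 := by
    rw [jacMap_Δ]
    simp [rowMinor, columnField, Δ_eq]
    ring
  simp only [AR, LinearMap.mem_ker, jacMap_mul, h012, h013, h023, h014, h234, h]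
  ring

theorem eval_base_eq_zero_of_mul_eq {c d e : S} (h : Δ 0 1 3 * c = Δ 0 1 2 * d + Δ 0 1 4 * e) :
    eval base c = 0 := by
  have h1 := congrArg (aeval (line ![0, 0, 0, 1, 0])) h
  simp only [map_add, map_mul, aeval_line_Δ] at h1
  have h2 : aeval (line ![0, 0, 0, 1, 0]) c = 0 := by
    simpa [rowMinor, row₀, row₁] using h1
  rw [← eval_zero_line ![0, 0, 0, 1, 0], ← eval_zero_aeval, h2, Polynomial.eval_zero]

/-- The arrangement `A : f₁ f₂ f₃ f₅ f₁₀ = 0` is not free. -/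
theorem not_free_A : ¬ Module.Free S (AR (f 0 * f 1 * f 2 * f 4 * f 9)) := by
  intro hfree
  change Module.Free S (AR (Δ 0 1 2 * Δ 0 1 3 * Δ 0 2 3 * Δ 0 1 4 * Δ 2 3 4)) at hfree
  let b := Module.Free.chooseBasis S (AR (Δ 0 1 2 * Δ 0 1 3 * Δ 0 2 3 * Δ 0 1 4 * Δ 2 3 4))
  let m₁ : AR (Δ 0 1 2 * Δ 0 1 3 * Δ 0 2 3 * Δ 0 1 4 * Δ 2 3 4) :=
    ⟨columnField (Δ 0 1 4) 0 (Δ 0 1 2), columnField_mem (by ring)⟩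
  let m₂ : AR (Δ 0 1 2 * Δ 0 1 3 * Δ 0 2 3 * Δ 0 1 4 * Δ 2 3 4) :=
    ⟨columnField 0 (Δ 0 1 4) (Δ 0 1 3), columnField_mem (by ring)⟩
  let m₃ : AR (Δ 0 1 2 * Δ 0 1 3 * Δ 0 2 3 * Δ 0 1 4 * Δ 2 3 4) :=
    ⟨columnField (Δ 0 1 3) (-Δ 0 1 2) 0, columnField_mem (by ring)⟩
  have hrel : Δ 0 1 3 • m₁ = Δ 0 1 2 • m₂ + Δ 0 1 4 • m₃ := by
    ext1
    funext p
    simp only [m₁, m₂, m₃, columnField, Submodule.coe_add, Submodule.coe_smul, Pi.add_apply,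
      Pi.smul_apply, smul_eq_mul]
    split_ifs <;> ring
  have hcoord (k) : eval base (b.repr m₁ k) = 0 := by
    refine eval_base_eq_zero_of_mul_eq (d := b.repr m₂ k) (e := b.repr m₃ k) ?_
    simpa using congrArg (fun m => b.repr m k) hrel
  have hsum : crossRatioForm m₁ = ∑ k ∈ (b.repr m₁).support,
      b.repr m₁ k * crossRatioForm (b k) := by
    conv_lhs => rw [← b.linearCombination_repr m₁, Finsupp.linearCombination_apply, Finsupp.sum]
    simp
  have hzero : Polynomial.eval 0 (Polynomial.derivative
      (aeval (line ![0, 0, 0, 0, 1]) (crossRatioForm m₁))) = 0 := by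
    rw [hsum, map_sum, Polynomial.derivative_sum, Polynomial.eval_finsetSum]
    refine Finset.sum_eq_zero fun k _ => ?_
    simp [Polynomial.derivative_mul, eval_zero_aeval, eval_zero_line, hcoord k,
      eval_base_crossRatioForm (b k).2]
  have hval : crossRatioForm m₁ = 5 * Δ 0 1 4 * (X (1, 2) - 2 * X (0, 2)) := by
    simp [crossRatioForm, m₁, columnField]
    ring
  rw [hval] at hzero
  simp only [map_mul, aeval_line_Δ] at hzero
  norm_num [rowMinor, row₀, row₁, line] at hzero
  simp only [Matrix.cons_val] at hzero
  norm_num at hzero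
end
end

section
/- The determinantal hypersurface arrangement B in P^14 defined by F = f₆·f₇·f₈·f₉·f₁₀ (a product of 5 consecutive minors) is not free; that is, the module of Jacobian syzygies AR(F) is not a free S-module. -/
open MvPolynomial

noncomputable section

theorem jacMap_eq_mkDerivation (a : Fin 3 × Fin 5 → S) (F : S) :
    jacMap F a = mkDerivation ℂ a F := by
  have sum_apply (G : S) :
      (∑ v, a v • pderiv (R := ℂ) v) G = ∑ v, a v * pderiv v G := by
    rw [← Derivation.coeFnAddMonoidHom_apply, map_sum, Finset.sum_apply]
    rfl
  have h : mkDerivation ℂ a = ∑ v, a v • pderiv (R := ℂ) v := by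
    refine derivation_ext fun v => ?_
    simp [sum_apply, pderiv_X, Pi.single_apply]
  rw [h, sum_apply]
  rfl

theorem exists_ne_zero_linear_part_eq_zero {σ : Type} [Fintype σ]
    (N : Submodule (MvPolynomial σ ℂ) (σ → MvPolynomial σ ℂ))
    [Module.Free (MvPolynomial σ ℂ) N]
    (hN : ∀ a ∈ N, ∀ v, constantCoeff (a v) = 0)
    {V : Type} [AddCommGroup V] [Module ℂ V] [Module.Finite ℂ V]
    (hV : Fintype.card σ < Module.finrank ℂ V)
    (φ : V →ₗ[ℂ] (σ → MvPolynomial σ ℂ)) (hφ : ∀ x, φ x ∈ N) :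
    ∃ x ≠ 0, ∀ v w, constantCoeff (pderiv w (φ x v)) = 0 := by
  let b := Module.Free.chooseBasis (MvPolynomial σ ℂ) N
  have hcard : Fintype.card (Module.Free.ChooseBasisIndex (MvPolynomial σ ℂ) N) ≤
      Fintype.card σ := by
    have := (b.linearIndependent.map' N.subtype N.ker_subtype).fintype_card_le_finrank
    simpa using this
  let ψ : V →ₗ[ℂ] N := φ.codRestrict (N.restrictScalars ℂ) hφ
  let L : V →ₗ[ℂ] (Module.Free.ChooseBasisIndex (MvPolynomial σ ℂ) N → ℂ) :=
    { toFun := fun x i => constantCoeff (b.repr (ψ x) i)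
      map_add' := fun x y => by ext i; simp
      map_smul' := fun c x => by
        ext i
        have : c • ψ x = (C c : MvPolynomial σ ℂ) • ψ x := by
          ext v; simp [smul_eq_C_mul]
        rw [map_smul, this]
        simp }
  have hker : LinearMap.ker L ≠ ⊥ := LinearMap.ker_ne_bot_of_finrank_lt (by simp; omega)
  obtain ⟨x, hx, hx0⟩ := Submodule.exists_mem_ne_zero_of_ne_bot hker
  refine ⟨x, hx0, fun v w => ?_⟩
  have hsum : φ x v = ∑ i, b.repr (ψ x) i * (b i : σ → MvPolynomial σ ℂ) v := by
    have := congrArg (fun y : N => (y : σ → MvPolynomial σ ℂ) v) (b.sum_repr (ψ x))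
    rw [← LinearMap.codRestrict_apply (N.restrictScalars ℂ) φ (h := hφ) x]
    refine this.symm.trans ?_
    simp only [Submodule.coe_sum, Submodule.coe_smul, Finset.sum_apply, Pi.smul_apply, smul_eq_mul]
  have hL (i) : constantCoeff (b.repr (ψ x) i) = 0 := congrFun hx i
  simp [hsum, Derivation.leibniz, hL, hN _ (b _).2]

/-- The linear vector field `M ↦ A M + M B`, where `B` has diagonal `d`, last row `c + d₄ e₄`
and zeros elsewhere. -/
def linField (A : Matrix (Fin 3) (Fin 3) ℂ) (c d : Fin 5 → ℂ) (v : Fin 3 × Fin 5) : S :=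
  ∑ k, C (A v.1 k) * X (k, v.2) + C (d v.2) * X v + C (c v.2) * X (v.1, 4)

theorem mkDerivation_linField_minor (A : Matrix (Fin 3) (Fin 3) ℂ) (c d : Fin 5 → ℂ)
    (hc : c 4 = 0) (i j : Fin 5) : mkDerivation ℂ (linField A c d) (Δ i j 4) =
      C (A.trace + d i + d j + d 4) * Δ i j 4 := by
  simp only [Δ, Matrix.det_fin_three, Matrix.of_apply, map_add, map_sub, Derivation.leibniz,
    mkDerivation_X, linField, smul_eq_mul, Matrix.trace, Matrix.diag_apply, Fin.sum_univ_three]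
  simp [hc]
  ring

theorem linField_mem_AR (A : Matrix (Fin 3) (Fin 3) ℂ) (c d : Fin 5 → ℂ) (hc : c 4 = 0)
    (hd : 5 * A.trace + 2 * d 0 + 2 * d 1 + 3 * d 2 + 3 * d 3 + 5 * d 4 = 0) :
    linField A c d ∈ AR (f 5 * f 6 * f 7 * f 8 * f 9) := by
  have hd' := congrArg (C : ℂ → S) hd
  change jacMap _ _ = 0
  rw [jacMap_eq_mkDerivation]
  change mkDerivation ℂ _ (Δ 0 2 4 * Δ 1 2 4 * Δ 0 3 4 * Δ 1 3 4 * Δ 2 3 4) = 0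
  simp only [Derivation.leibniz, mkDerivation_linField_minor _ _ _ hc, smul_eq_mul, map_add,
    map_mul, map_ofNat, map_zero] at hd' ⊢
  linear_combination (Δ 0 2 4 * Δ 1 2 4 * Δ 0 3 4 * Δ 1 3 4 * Δ 2 3 4) * hd'

/-- The linear syzygies with `d₀ = 0`, which removes the scalar matrices. -/
def linSyzygy : (Matrix (Fin 3) (Fin 3) ℂ × (Fin 4 → ℂ) × (Fin 3 → ℂ)) →ₗ[ℂ]
    (Fin 3 × Fin 5 → S) where
  toFun x := linField x.1 ![x.2.1 0, x.2.1 1, x.2.1 2, x.2.1 3, 0]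
    ![0, x.2.2 0, x.2.2 1, x.2.2 2,
      -x.1.trace - (2 * x.2.2 0 + 3 * x.2.2 1 + 3 * x.2.2 2) / 5]
  map_add' x y := by
    ext1 ⟨i, j⟩
    fin_cases j <;> simp [linField, Fin.sum_univ_three, sub_eq_add_neg, add_div, C_add, mul_add] <;>
      ring
  map_smul' r x := by
    ext1 ⟨i, j⟩
    have : (-(r * x.1.trace) - (2 * (r * x.2.2 0) + 3 * (r * x.2.2 1) + 3 * (r * x.2.2 2)) / 5) =
      r * (-x.1.trace - (2 * x.2.2 0 + 3 * x.2.2 1 + 3 * x.2.2 2) / 5) := by ring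
    fin_cases j <;> simp [linField, Fin.sum_univ_three, this, -map_sub, -map_neg, smul_eq_C_mul] <;>
      ring

theorem linSyzygy_mem_AR (x) : linSyzygy x ∈ AR (f 5 * f 6 * f 7 * f 8 * f 9) := by
  refine linField_mem_AR _ _ _ rfl ?_
  simp
  ring

theorem eq_zero_of_linear_part_eq_zero
    (x : Matrix (Fin 3) (Fin 3) ℂ × (Fin 4 → ℂ) × (Fin 3 → ℂ))
    (h : ∀ v w, constantCoeff (pderiv w (linSyzygy x v)) = 0) : x = 0 := by
  obtain ⟨A, c, d⟩ := x
  have hA : A = 0 := by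
    ext i k
    have := h (i, 0) (k, 0)
    fin_cases i <;> fin_cases k <;>
      simpa [linSyzygy, linField, Fin.sum_univ_three, pderiv_X, Pi.single_apply,
        Derivation.leibniz] using this
  subst hA
  have hd : d = 0 := by
    ext j
    have := h (0, j.succ.castSucc) (0, j.succ.castSucc)
    fin_cases j <;>
      simpa [linSyzygy, linField, Fin.sum_univ_three, pderiv_X, Pi.single_apply,
        Derivation.leibniz] using this
  subst hd
  have hc : c = 0 := by
    ext j
    have := h (0, j.castSucc) (0, 4)
    fin_cases j <;>
      simpa [linSyzygy, linField, Fin.sum_univ_three, pderiv_X, Pi.single_apply,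
        Derivation.leibniz] using this
  subst hc
  rfl

theorem eval_mkDerivation_eq_zero_of_mul {σ : Type} {D : Derivation ℂ (MvPolynomial σ ℂ)
    (MvPolynomial σ ℂ)} {p : σ → ℂ} {G H : MvPolynomial σ ℂ} (hG : eval p G = 0)
    (hH : eval p H ≠ 0) (h : eval p (D (G * H)) = 0) : eval p (D G) = 0 := by
  simpa [Derivation.leibniz, hG, hH] using h

/-- The matrix with the given columns, as a point of affine space. -/
def ofColumns (v : Fin 5 → Fin 3 → ℂ) (w : Fin 3 × Fin 5) : ℂ := v w.2 w.1

theorem eval_ofColumns_minor (v : Fin 5 → Fin 3 → ℂ) (a b c : Fin 5) :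
    eval (ofColumns v) (Δ a b c) = Matrix.det (Matrix.of ![v a, v b, v c]) := by
  simp [Δ, Matrix.det_fin_three, ofColumns]
  ring

theorem eval_ofColumns_mkDerivation_minor (u : Fin 3 × Fin 5 → ℂ) (v : Fin 5 → Fin 3 → ℂ)
    (a b c : Fin 5) :
    eval (ofColumns v) (mkDerivation ℂ (fun w => C (u w) : _ → S) (Δ a b c)) =
      Matrix.det (Matrix.of ![fun i => u (i, a), v b, v c]) +
        Matrix.det (Matrix.of ![v a, fun i => u (i, b), v c]) +
        Matrix.det (Matrix.of ![v a, v b, fun i => u (i, c)]) := by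
  simp [Δ, Matrix.det_fin_three, ofColumns, Derivation.leibniz, mkDerivation_X]
  ring

theorem eq_zero_of_constant_field (u : Fin 3 × Fin 5 → ℂ)
    (h : ∀ p, eval p (mkDerivation ℂ (fun w => C (u w) : _ → S)
      (f 5 * f 6 * f 7 * f 8 * f 9)) = 0) : u = 0 := by
  change ∀ p, eval p (mkDerivation ℂ _ (Δ 0 2 4 * Δ 1 2 4 * Δ 0 3 4 * Δ 1 3 4 * Δ 2 3 4)) = 0 at h
  have h₀ (t : Fin 3) (α β : ℂ) (hα : α ≠ 0) :
      u (t, 0) - α * u (t, 2) - β * u (t, 4) = 0 := by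
    let p : Fin 5 → Fin 3 → ℂ := ![α • Pi.single (t + 1) 1 + β • Pi.single (t + 2) 1,
      Pi.single (t + 1) 1 + Pi.single t 1, Pi.single (t + 1) 1, Pi.single t 1,
      Pi.single (t + 2) 1]
    have := eval_mkDerivation_eq_zero_of_mul (p := ofColumns p)
      (G := Δ 0 2 4) (H := Δ 1 2 4 * Δ 0 3 4 * Δ 1 3 4 * Δ 2 3 4)
      (D := mkDerivation ℂ (fun w => C (u w)))
      (by fin_cases t <;> simp [eval_ofColumns_minor, p, Matrix.det_fin_three])
      (by fin_cases t <;> simp [eval_ofColumns_minor, p, Matrix.det_fin_three, hα])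
      (by simpa only [mul_assoc] using h (ofColumns p))
    rw [eval_ofColumns_mkDerivation_minor] at this
    fin_cases t <;> simp [p, Matrix.det_fin_three] at this ⊢ <;> linear_combination this
  have h₁ (t : Fin 3) (α β : ℂ) (hα : α ≠ 0) :
      u (t, 1) - α * u (t, 3) - β * u (t, 4) = 0 := by
    let p : Fin 5 → Fin 3 → ℂ := ![Pi.single (t + 1) 1 + Pi.single t 1,
      α • Pi.single (t + 1) 1 + β • Pi.single (t + 2) 1, Pi.single t 1, Pi.single (t + 1) 1,
      Pi.single (t + 2) 1]
    have := eval_mkDerivation_eq_zero_of_mul (p := ofColumns p)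
      (G := Δ 1 3 4) (H := Δ 0 2 4 * Δ 1 2 4 * Δ 0 3 4 * Δ 2 3 4)
      (D := mkDerivation ℂ (fun w => C (u w)))
      (by fin_cases t <;> simp [eval_ofColumns_minor, p, Matrix.det_fin_three])
      (by fin_cases t <;> simp [eval_ofColumns_minor, p, Matrix.det_fin_three, hα])
      (by
        convert h (ofColumns p) using 3
        ring)
    rw [eval_ofColumns_mkDerivation_minor] at this
    fin_cases t <;> simp [p, Matrix.det_fin_three] at this ⊢ <;> linear_combination this
  ext ⟨t, j⟩
  have a := h₀ t 1 0 one_ne_zero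
  have b := h₀ t 2 0 two_ne_zero
  have c := h₀ t 1 1 one_ne_zero
  have d := h₁ t 1 0 one_ne_zero
  have e := h₁ t 2 0 two_ne_zero
  change u (t, j) = 0
  fin_cases j <;> simp only [Fin.reduceFinMk, Fin.zero_eta, Fin.mk_one]
  · linear_combination 2 * a - b
  · linear_combination 2 * d - e
  · linear_combination a - b
  · linear_combination d - e
  · linear_combination a - c

theorem isHomogeneous_minor (a b c : Fin 5) : (Δ a b c).IsHomogeneous 3 := by
  have h (w₁ w₂ w₃ : Fin 3 × Fin 5) : (X w₁ * X w₂ * X w₃ : S).IsHomogeneous 3 :=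
    ((isHomogeneous_X ℂ w₁).mul (isHomogeneous_X ℂ w₂)).mul (isHomogeneous_X ℂ w₃)
  rw [Δ, Matrix.det_fin_three]
  exact (((((h _ _ _).sub (h _ _ _)).sub (h _ _ _)).add (h _ _ _)).add (h _ _ _)).sub (h _ _ _)

theorem sum_constantCoeff_mul_eval_pderiv_eq_zero {σ : Type} [Fintype σ] [DecidableEq σ]
    {F : MvPolynomial σ ℂ} {n : ℕ} (hF : F.IsHomogeneous n) {a : σ → MvPolynomial σ ℂ}
    (ha : a ∈ AR F) (p : σ → ℂ) : ∑ v, constantCoeff (a v) * eval p (pderiv v F) = 0 := by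
  have scale (v : σ) (t : ℂ) :
      eval (t • p) (pderiv v F) = t ^ (n - 1) * eval p (pderiv v F) := by
    have hv := hF.pderiv (i := v)
    simp only [eval_eq, Finset.mul_sum]
    refine Finset.sum_congr rfl fun d hd => ?_
    have hdeg := hv (mem_support_iff.mp hd)
    rw [Finsupp.weight_apply] at hdeg
    simp only [Pi.smul_apply, smul_eq_mul, mul_pow, Finset.prod_mul_distrib,
      Finset.prod_pow_eq_pow_sum]
    rw [← hdeg]
    simp [Finsupp.sum]
    ring
  let g : ℂ → ℂ := fun t => ∑ v, eval (t • p) (a v) * eval p (pderiv v F)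
  have hg : Continuous g := by
    refine continuous_finsetSum _ fun v _ => ?_
    exact ((continuous_eval (a v)).comp (by fun_prop : Continuous fun t : ℂ => t • p)).mul_const _
  have hne : Set.EqOn g 0 {0}ᶜ := fun t ht => by
    have hsum := congrArg (eval (t • p)) (show jacMap F a = 0 from ha)
    simp only [jacMap, LinearMap.coe_mk, AddHom.coe_mk, map_sum, map_mul, map_zero, scale] at hsum
    have : t ^ (n - 1) * g t = 0 := by
      rw [← hsum, Finset.mul_sum]
      exact Finset.sum_congr rfl fun v _ => by ring
    exact (mul_eq_zero.mp this).resolve_left (pow_ne_zero _ ht)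
  have := congrFun (hg.ext_on (dense_compl_singleton 0) continuous_zero hne) 0
  simpa [g, eval_zero] using this

theorem constantCoeff_eq_zero_of_mem_AR {a : Fin 3 × Fin 5 → S}
    (ha : a ∈ AR (f 5 * f 6 * f 7 * f 8 * f 9)) (v : Fin 3 × Fin 5) :
    constantCoeff (a v) = 0 := by
  have hF : (f 5 * f 6 * f 7 * f 8 * f 9).IsHomogeneous 15 :=
    ((((isHomogeneous_minor 0 2 4).mul (isHomogeneous_minor 1 2 4)).mul
      (isHomogeneous_minor 0 3 4)).mul (isHomogeneous_minor 1 3 4)).mul (isHomogeneous_minor 2 3 4)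
  refine congrFun (eq_zero_of_constant_field (fun v => constantCoeff (a v)) fun p => ?_) v
  rw [← jacMap_eq_mkDerivation]
  simpa [jacMap] using sum_constantCoeff_mul_eval_pderiv_eq_zero hF ha p

/-- The arrangement `B : f₆ f₇ f₈ f₉ f₁₀ = 0` of five consecutive minors is not free. -/
theorem not_free_B : ¬ Module.Free S (AR (f 5 * f 6 * f 7 * f 8 * f 9)) := by
  intro hfree
  obtain ⟨x, hx, hx0⟩ := exists_ne_zero_linear_part_eq_zero _
    (fun a ha => constantCoeff_eq_zero_of_mem_AR ha) (by simp [Module.finrank_matrix])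
    linSyzygy linSyzygy_mem_AR
  exact hx (eq_zero_of_linear_part_eq_zero x hx0)
end
end

section
/- (Buchweitz–Mond) Let n ≥ 2 and let M be the generic n×(n+1) matrix of indeterminates over the polynomial ring R = ℂ[x_{i,j} : 1 ≤ i ≤ n, 1 ≤ j ≤ n+1], and let F ∈ R be the product of the n+1 maximal (n×n) minors of M, where the j-th maximal minor is the determinant of the n×n matrix obtained from M by deleting column j. Then the hypersurface arrangement defined by F is free; that is, the module of Jacobian syzygies AR(F) = { (a_v)_v ∈ R^{n(n+1)} : Σ_v a_v · ∂F/∂x_v = 0 } is a free R-module. -/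
open MvPolynomial

noncomputable section

/-- The `j`-th maximal minor of the generic `n × (n+1)` matrix: the determinant of the
`n × n` matrix obtained by deleting column `j`. -/
def maximalMinor (n : ℕ) (j : Fin (n + 1)) : MvPolynomial (Fin n × Fin (n + 1)) ℂ :=
  Matrix.det (Matrix.of fun i k : Fin n => X (i, j.succAbove k))

open Matrix

/-- Leibniz rule for a derivation applied to a finite product. -/
theorem Derivation.leibniz_finset_prod {k A ι : Type*} [CommRing k] [CommRing A] [Algebra k A]
    [DecidableEq ι] (D : Derivation k A A) (s : Finset ι) (g : ι → A) :
    D (∏ i ∈ s, g i) = ∑ i ∈ s, (∏ l ∈ s.erase i, g l) * D (g i) := by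
  induction s using Finset.induction_on with
  | empty => simp
  | insert a s ha ih =>
    rw [Finset.prod_insert ha, D.leibniz, ih, Finset.sum_insert ha, Finset.erase_insert ha,
      smul_eq_mul, smul_eq_mul, add_comm, Finset.mul_sum]
    congr 1
    refine Finset.sum_congr rfl fun i hi => ?_
    have hia : a ≠ i := fun h => ha (h ▸ hi)
    rw [Finset.erase_insert_of_ne hia, Finset.prod_insert (by simp [ha]), mul_assoc]

/-- Jacobi's formula for a derivation applied to a determinant. -/
theorem Derivation.map_det {k A ι : Type*} [CommRing k] [CommRing A] [Algebra k A]
    [DecidableEq ι] [Fintype ι] (D : Derivation k A A) (N : Matrix ι ι A) :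
    D N.det = (N.adjugate * N.map D).trace := by
  have key : ∀ k, (N.adjugate * N.map D) k k = (N.updateCol k fun i => D (N i k)).det := by
    intro k
    rw [← cramer_apply, cramer_eq_adjugate_mulVec]
    rfl
  simp only [Matrix.trace, Matrix.diag, key]
  simp_rw [det_apply', map_sum]
  rw [Finset.sum_comm]
  refine Finset.sum_congr rfl fun σ _ => ?_
  have hsign : D (((Equiv.Perm.sign σ : ℤ) : A)) = 0 := by simp
  rw [D.leibniz, hsign, smul_zero, add_zero, D.leibniz_finset_prod, smul_eq_mul, Finset.mul_sum]
  refine Finset.sum_congr rfl fun k _ => ?_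
  rw [← Finset.prod_erase_mul _ _ (Finset.mem_univ k), updateCol_self]
  congr 2
  exact Finset.prod_congr rfl fun l hl => (updateCol_ne (Finset.ne_of_mem_erase hl)).symm

/-- The kernel of a linear functional taking the value `1` on a basis vector is free. -/
theorem LinearMap.free_ker_of_basis {A V ι : Type*} [CommRing A] [AddCommGroup V] [Module A V]
    [Fintype ι] (b : Module.Basis ι A V) (φ : V →ₗ[A] A) (i₀ : ι) (h : φ (b i₀) = 1) :
    Module.Free A (LinearMap.ker φ) := by
  classical
  let f : LinearMap.ker φ →ₗ[A] ({i // i ≠ i₀} → A) :=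
    LinearMap.pi (fun i => b.coord i.1) ∘ₗ (LinearMap.ker φ).subtype
  have hf : Function.Bijective f := by
    constructor
    · rw [← LinearMap.ker_eq_bot, LinearMap.ker_eq_bot']
      rintro ⟨x, hx⟩ hfx
      have hc : ∀ i, i ≠ i₀ → b.repr x i = 0 := fun i hi => congrFun hfx ⟨i, hi⟩
      have hs : x = b.repr x i₀ • b i₀ := by
        conv_lhs => rw [← b.sum_repr x]
        exact Finset.sum_eq_single i₀ (fun i _ hi => by rw [hc i hi, zero_smul]) (by simp)
      have h0 : b.repr x i₀ = 0 := by
        have := LinearMap.mem_ker.1 hx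
        rwa [hs, map_smul, h, smul_eq_mul, mul_one] at this
      ext
      change x = 0
      rw [hs, h0, zero_smul]
    · intro y
      let z : V := ∑ i : {i // i ≠ i₀}, y i • b i
      refine ⟨⟨z - φ z • b i₀, by simp [h]⟩, ?_⟩
      ext i
      change b.repr (z - φ z • b i₀) i = y i
      simp only [z, map_sub, map_sum, map_smul, Module.Basis.repr_self, Finsupp.sub_apply,
        Finsupp.finsetSum_apply, Finsupp.smul_apply, Finsupp.single_apply, smul_eq_mul]
      simp [Subtype.coe_injective.eq_iff, i.2.symm]
  exact Module.Free.of_equiv (LinearEquiv.ofBijective f hf).symm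

section HilbertBurch

variable {A : Type*} [CommRing A] {n : ℕ} (M : Matrix (Fin n) (Fin (n + 1)) A)

/-- Each row of `M` is orthogonal to the vector of signed maximal minors. -/
theorem sum_signed_minors_mul_row (i : Fin n) :
    ∑ j : Fin (n + 1), M i j * ((-1) ^ (j : ℕ) * (M.submatrix id j.succAbove).det) = 0 := by
  have h := det_succ_row_zero (Matrix.of (Fin.cons (M i) M : Fin (n + 1) → Fin (n + 1) → A))
  rw [det_zero_of_row_eq (i := 0) (j := i.succ) (Fin.succ_ne_zero i).symm (by ext l; rfl)] at h
  rw [h]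
  refine Finset.sum_congr rfl fun j _ => ?_
  rw [mul_left_comm, ← mul_assoc]
  rfl

theorem det_submatrix_smul_eq_vecMul [IsDomain A] {b : Fin (n + 1) → A}
    (hb : ∑ j : Fin (n + 1), b j * ((-1) ^ (j : ℕ) * (M.submatrix id j.succAbove).det) = 0)
    (j : Fin (n + 1)) (hj : (M.submatrix id j.succAbove).det ≠ 0) :
    ((fun k => b (j.succAbove k)) ᵥ* (M.submatrix id j.succAbove).adjugate) ᵥ* M
      = (M.submatrix id j.succAbove).det • b := by
  set c := (fun k => b (j.succAbove k)) ᵥ* (M.submatrix id j.succAbove).adjugate with hc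
  have hoff : ∀ k, (c ᵥ* M) (j.succAbove k)
      = (M.submatrix id j.succAbove).det * b (j.succAbove k) := by
    intro k
    have : (c ᵥ* M) (j.succAbove k) = (c ᵥ* M.submatrix id j.succAbove) k := rfl
    rw [this, hc, vecMul_vecMul, adjugate_mul, vecMul_smul, vecMul_one]
    rfl
  have hcM : ∑ l : Fin (n + 1),
      (c ᵥ* M) l * ((-1) ^ (l : ℕ) * (M.submatrix id l.succAbove).det) = 0 := by
    simp only [vecMul, dotProduct, Finset.sum_mul]
    rw [Finset.sum_comm]
    refine Finset.sum_eq_zero fun i _ => ?_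
    simp only [mul_assoc (c i), ← Finset.mul_sum]
    rw [sum_signed_minors_mul_row, mul_zero]
  have hdiff : ((c ᵥ* M) j - (M.submatrix id j.succAbove).det * b j)
      * ((-1) ^ (j : ℕ) * (M.submatrix id j.succAbove).det) = 0 := by
    have h2 := congrArg ((M.submatrix id j.succAbove).det * ·) hb
    simp only [mul_zero] at h2
    rw [Fin.sum_univ_succAbove _ j, mul_add, Finset.mul_sum] at h2
    rw [Fin.sum_univ_succAbove _ j] at hcM
    simp only [hoff] at hcM
    simp only [← mul_assoc] at h2 hcM ⊢
    linear_combination hcM - h2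
  have hne : (-1 : A) ^ (j : ℕ) * (M.submatrix id j.succAbove).det ≠ 0 :=
    mul_ne_zero (pow_ne_zero _ (neg_ne_zero.2 one_ne_zero)) hj
  have hjj := sub_eq_zero.1 ((mul_eq_zero.1 hdiff).resolve_right hne)
  ext l
  obtain rfl | ⟨k, rfl⟩ := Fin.eq_self_or_eq_succAbove j l
  · exact hjj
  · exact hoff k

/-- Exactness in the middle of the Hilbert–Burch complex, when two of the maximal minors of `M`
are relatively prime. -/
theorem exists_vecMul_eq_of_sum_signed_minors [IsDomain A] [DecompositionMonoid A]
    {b : Fin (n + 1) → A}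
    (hb : ∑ j : Fin (n + 1), b j * ((-1) ^ (j : ℕ) * (M.submatrix id j.succAbove).det) = 0)
    (j k : Fin (n + 1)) (hj : (M.submatrix id j.succAbove).det ≠ 0)
    (hk : (M.submatrix id k.succAbove).det ≠ 0)
    (hjk : IsRelPrime (M.submatrix id j.succAbove).det (M.submatrix id k.succAbove).det) :
    ∃ c : Fin n → A, c ᵥ* M = b := by
  have h1 := det_submatrix_smul_eq_vecMul M hb j hj
  have h2 := det_submatrix_smul_eq_vecMul M hb k hk
  set u := (fun l => b (j.succAbove l)) ᵥ* (M.submatrix id j.succAbove).adjugate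
  set w := (fun l => b (k.succAbove l)) ᵥ* (M.submatrix id k.succAbove).adjugate
  set d := (M.submatrix id j.succAbove).det with hd
  set e := (M.submatrix id k.succAbove).det
  have h3 : (e • u - d • w) ᵥ* M = 0 := by
    rw [sub_vecMul, smul_vecMul, smul_vecMul, h1, h2, smul_comm, sub_self]
  have h4 : e • u - d • w = 0 := by
    refine eq_zero_of_vecMul_eq_zero hj ?_
    ext l
    exact congrFun h3 (j.succAbove l)
  have h5 : ∀ i, d ∣ u i := fun i => by
    refine hjk.dvd_of_dvd_mul_left ⟨w i, ?_⟩
    exact sub_eq_zero.1 (congrFun h4 i)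
  choose c hc using h5
  refine ⟨c, ?_⟩
  have h6 : u = d • c := funext hc
  rw [h6, smul_vecMul] at h1
  ext l
  exact mul_left_cancel₀ hj (congrFun h1 l)

end HilbertBurch

section Minors

variable {n : ℕ}

/-- The generic `n × (n+1)` matrix. -/
abbrev genericMatrix (n : ℕ) :
    Matrix (Fin n) (Fin (n + 1)) (MvPolynomial (Fin n × Fin (n + 1)) ℂ) :=
  Matrix.of fun i j => X (i, j)

theorem maximalMinor_eq_det_submatrix (j : Fin (n + 1)) :
    maximalMinor n j = ((genericMatrix n).submatrix id j.succAbove).det := rfl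

theorem maximalMinor_ne_zero (j : Fin (n + 1)) : maximalMinor n j ≠ 0 := by
  intro h
  have h1 := congrArg (eval fun v : Fin n × Fin (n + 1) =>
    if v.2 = j.succAbove v.1 then (1 : ℂ) else 0) h
  rw [maximalMinor, RingHom.map_det, map_zero] at h1
  refine one_ne_zero (α := ℂ) ?_
  rw [← h1, ← det_one (n := Fin n)]
  congr 1
  ext i k
  simp [Matrix.one_apply, eq_comm]

theorem Matrix.det_mem_subalgebra {k A ι : Type*} [CommRing k] [CommRing A] [Algebra k A]
    [DecidableEq ι] [Fintype ι] (S : Subalgebra k A) {N : Matrix ι ι A}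
    (h : ∀ i j, N i j ∈ S) : N.det ∈ S := by
  rw [det_apply]
  refine sum_mem fun σ _ => ?_
  rw [Units.smul_def]
  exact zsmul_mem (prod_mem fun i _ => h _ _) _

theorem MvPolynomial.mem_supported_of_dvd {k σ : Type*} [CommRing k] [IsDomain k] {s : Set σ}
    {p q : MvPolynomial σ k} (hq : q ≠ 0) (hqs : q ∈ supported k s) (h : p ∣ q) :
    p ∈ supported k s := by
  classical
  obtain ⟨r, rfl⟩ := h
  rw [mem_supported] at hqs ⊢
  refine subset_trans ?_ hqs
  intro v hv
  simp only [Finset.mem_coe, vars_def, Multiset.mem_toFinset] at hv ⊢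
  rw [degrees_mul_eq (left_ne_zero_of_mul hq) (right_ne_zero_of_mul hq)]
  exact Multiset.mem_add.2 (Or.inl hv)

/-- The maximal minor with column `j` deleted involves no variable of column `j`. -/
theorem maximalMinor_mem_supported (j : Fin (n + 1)) :
    maximalMinor n j ∈ supported ℂ {v : Fin n × Fin (n + 1) | v.2 ≠ j} :=
  Matrix.det_mem_subalgebra _ fun _ k => X_mem_supported.2 (Fin.succAbove_ne j k)

theorem pderiv_maximalMinor (j : Fin (n + 1)) (i k : Fin n) :
    pderiv (i, j.succAbove k) (maximalMinor n j)
      = ((genericMatrix n).submatrix id j.succAbove).adjugate k i := by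
  rw [maximalMinor_eq_det_submatrix, Derivation.map_det]
  have : ((genericMatrix n).submatrix id j.succAbove).map (pderiv (i, j.succAbove k))
      = Matrix.single i k 1 := by
    ext1 a b
    simp [pderiv_X, Matrix.single_apply, Pi.single_apply, eq_comm]
  rw [this, Matrix.trace_mul_single]
  simp

theorem adjugate_genericMatrix_mem_supported (j : Fin (n + 1)) (i k : Fin n) :
    ((genericMatrix n).submatrix id j.succAbove).adjugate k i
      ∈ supported ℂ {v : Fin n × Fin (n + 1) | v.1 ≠ i} := by
  rw [adjugate_apply]
  refine Matrix.det_mem_subalgebra _ fun a b => ?_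
  by_cases ha : a = i
  · subst ha
    rw [updateRow_self, Pi.single_apply]
    split_ifs
    · exact one_mem _
    · exact zero_mem _
  · rw [updateRow_ne ha]
    exact X_mem_supported.2 ha

theorem adjugate_genericMatrix_ne_zero (j : Fin (n + 1)) (i k : Fin n) :
    ((genericMatrix n).submatrix id j.succAbove).adjugate k i ≠ 0 := by
  intro h
  have h1 := congrArg (eval fun v : Fin n × Fin (n + 1) =>
    if v.2 = j.succAbove (Equiv.swap i k v.1) then (1 : ℂ) else 0) h
  rw [adjugate_apply, RingHom.map_det, map_zero] at h1
  have h2 := det_permutation (R := ℂ) (Equiv.swap i k)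
  have h3 : (((Equiv.Perm.sign (Equiv.swap i k) : ℤ)) : ℂ) ≠ 0 :=
    Int.cast_ne_zero.2 (Units.ne_zero _)
  refine h3 ?_
  rw [← h2, ← h1]
  congr 1
  ext a b
  by_cases ha : a = i
  · subst ha
    simp [Equiv.Perm.permMatrix, PEquiv.toMatrix_apply, Pi.single_apply, eq_comm, apply_ite]
  · simp [Equiv.Perm.permMatrix, PEquiv.toMatrix_apply, updateRow_ne ha, eq_comm]

/-- Distinct maximal minors of the generic matrix are relatively prime. -/
theorem isRelPrime_maximalMinor {j k : Fin (n + 1)} (hjk : j ≠ k) :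
    IsRelPrime (maximalMinor n j) (maximalMinor n k) := by
  intro p hpj hpk
  have hcol := mem_supported_of_dvd (maximalMinor_ne_zero k) (maximalMinor_mem_supported k) hpk
  obtain ⟨k', rfl⟩ := Fin.exists_succAbove_eq hjk.symm
  have hrow : ∀ i, p ∈ supported ℂ {v : Fin n × Fin (n + 1) | v.1 ≠ i} := by
    intro i
    refine mem_supported_of_dvd (adjugate_genericMatrix_ne_zero j i k')
      (adjugate_genericMatrix_mem_supported j i k') ?_
    rw [← pderiv_maximalMinor]
    obtain ⟨q, hq⟩ := hpj
    have hp : pderiv (i, j.succAbove k') p = 0 := by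
      refine pderiv_eq_zero_of_notMem_vars fun hv => ?_
      exact mem_supported.1 hcol (Finset.mem_coe.2 hv) rfl
    rw [hq, pderiv_mul, hp, zero_mul, zero_add]
    exact dvd_mul_right _ _
  have hvars : p.vars = ∅ :=
    Finset.eq_empty_of_forall_notMem fun v hv => mem_supported.1 (hrow v.1) (Finset.mem_coe.2 hv) rfl
  have hp0 : p ≠ 0 := ne_zero_of_dvd_ne_zero (maximalMinor_ne_zero j) hpj
  rw [vars_eq_empty_iff_eq_C] at hvars
  rw [hvars] at hp0 ⊢
  exact (isUnit_iff_ne_zero.2 fun h => hp0 (by rw [h, C_0])).map C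

end Minors

section LogarithmicFields

variable {n : ℕ}

local notation "𝓡" => MvPolynomial (Fin n × Fin (n + 1)) ℂ

theorem jacMap_eq_mkDerivation_s9 {k σ : Type} [CommRing k] [Fintype σ] [DecidableEq σ]
    (F : MvPolynomial σ k) (a : σ → MvPolynomial σ k) :
    jacMap F a = mkDerivation k a F := by
  have h : ∀ G, (∑ v, a v • pderiv v : Derivation k (MvPolynomial σ k) (MvPolynomial σ k)) G
      = ∑ v, a v * pderiv v G := fun G => by
    rw [← Derivation.coeFnAddMonoidHom_apply, map_sum, Finset.sum_apply]
    rfl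
  change ∑ v, a v * pderiv v F = _
  rw [← h]
  congr 1
  refine derivation_ext fun i => ?_
  rw [h, mkDerivation_X]
  simp [pderiv_X, Pi.single_apply]

/-- The linear vector field `B * M + M * diagonal d` of the action of `GL n` and of the torus. -/
def actionField (n : ℕ) :
    (Matrix (Fin n) (Fin n) (MvPolynomial (Fin n × Fin (n + 1)) ℂ)
      × (Fin (n + 1) → MvPolynomial (Fin n × Fin (n + 1)) ℂ))
      →ₗ[MvPolynomial (Fin n × Fin (n + 1)) ℂ]
      (Fin n × Fin (n + 1) → MvPolynomial (Fin n × Fin (n + 1)) ℂ) where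
  toFun p v := (p.1 * genericMatrix n) v.1 v.2 + genericMatrix n v.1 v.2 * p.2 v.2
  map_add' p q := by
    ext1 v
    simp only [Prod.fst_add, Prod.snd_add, Matrix.add_mul, Matrix.add_apply, Pi.add_apply, mul_add]
    ring
  map_smul' c p := by
    ext1 v
    simp only [Prod.smul_fst, Prod.smul_snd, Matrix.smul_mul, Matrix.smul_apply, Pi.smul_apply,
      smul_eq_mul, RingHom.id_apply]
    ring

theorem mkDerivation_actionField_maximalMinor (B : Matrix (Fin n) (Fin n) 𝓡)
    (d : Fin (n + 1) → 𝓡) (j : Fin (n + 1)) :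
    mkDerivation ℂ (actionField n (B, d)) (maximalMinor n j)
      = (B.trace + ∑ k, d k - d j) * maximalMinor n j := by
  rw [maximalMinor_eq_det_submatrix, Derivation.map_det]
  set N := (genericMatrix n).submatrix id j.succAbove with hN
  have h : N.map (mkDerivation ℂ (actionField n (B, d)))
      = B * N + N * diagonal fun k => d (j.succAbove k) := by
    ext1 a b
    rw [Matrix.add_apply, mul_diagonal]
    simp only [hN, map_apply, submatrix_apply, of_apply, mkDerivation_X]
    rfl
  rw [h, Matrix.mul_add, trace_add, ← Matrix.mul_assoc, ← Matrix.mul_assoc, adjugate_mul,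
    trace_mul_comm, ← Matrix.mul_assoc, mul_adjugate, smul_mul, smul_mul, Matrix.one_mul,
    Matrix.one_mul, trace_smul, trace_smul, trace_diagonal, Fin.sum_univ_succAbove d j,
    smul_eq_mul, smul_eq_mul]
  ring

theorem mkDerivation_prod_maximalMinor (a : Fin n × Fin (n + 1) → 𝓡) (h : Fin (n + 1) → 𝓡)
    (hh : ∀ j, mkDerivation ℂ a (maximalMinor n j) = h j * maximalMinor n j) :
    mkDerivation ℂ a (∏ j, maximalMinor n j) = (∑ j, h j) * ∏ j, maximalMinor n j := by
  rw [Derivation.leibniz_finset_prod, Finset.sum_mul]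
  refine Finset.sum_congr rfl fun j _ => ?_
  rw [hh, ← Finset.prod_erase_mul _ _ (Finset.mem_univ j)]
  ring

theorem actionField_mem_AR {B : Matrix (Fin n) (Fin n) 𝓡} {d : Fin (n + 1) → 𝓡}
    (hB : B.trace = 0) (hd : ∑ k, d k = 0) :
    actionField n (B, d) ∈ AR (∏ j, maximalMinor n j) := by
  rw [AR, LinearMap.mem_ker, jacMap_eq_mkDerivation_s9,
    mkDerivation_prod_maximalMinor _ _ (mkDerivation_actionField_maximalMinor B d)]
  simp [hB, hd]

theorem eq_zero_of_actionField_eq_zero {B : Matrix (Fin n) (Fin n) 𝓡} {d : Fin (n + 1) → 𝓡}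
    (hB : B.trace = 0) (hd : ∑ k, d k = 0) (h : actionField n (B, d) = 0) : B = 0 ∧ d = 0 := by
  have hd0 : d = 0 := by
    ext1 j
    have h1 := mkDerivation_actionField_maximalMinor B d j
    have h2 : mkDerivation ℂ (0 : Fin n × Fin (n + 1) → 𝓡) = 0 :=
      derivation_ext fun i => by simp [mkDerivation_X]
    rw [h, h2, hB, hd, Derivation.zero_apply, zero_add, zero_sub, eq_comm, mul_eq_zero,
      neg_eq_zero] at h1
    exact h1.resolve_right (maximalMinor_ne_zero j)
  refine ⟨?_, hd0⟩
  ext1 i l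
  refine congrFun (eq_zero_of_vecMul_eq_zero (maximalMinor_ne_zero (n := n) 0) (v := B i) ?_) l
  ext1 k
  have hik : (B * genericMatrix n) i ((0 : Fin (n + 1)).succAbove k) = 0 := by
    simpa [actionField, hd0] using congrFun h (i, (0 : Fin (n + 1)).succAbove k)
  exact hik

/-- A derivation killing the product of the maximal minors is logarithmic along each of them. -/
theorem exists_mkDerivation_maximalMinor_eq_mul {a : Fin n × Fin (n + 1) → 𝓡}
    (ha : mkDerivation ℂ a (∏ j, maximalMinor n j) = 0) (j : Fin (n + 1)) :
    ∃ c, mkDerivation ℂ a (maximalMinor n j) = c * maximalMinor n j := by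
  rw [Derivation.leibniz_finset_prod, ← Finset.add_sum_erase _ _ (Finset.mem_univ j)] at ha
  have h1 : maximalMinor n j ∣ ∑ l ∈ Finset.univ.erase j,
      (∏ m ∈ Finset.univ.erase l, maximalMinor n m) * mkDerivation ℂ a (maximalMinor n l) := by
    refine Finset.dvd_sum fun l hl => Dvd.dvd.mul_right (Finset.dvd_prod_of_mem _ ?_) _
    exact Finset.mem_erase.2 ⟨(Finset.ne_of_mem_erase hl).symm, Finset.mem_univ _⟩
  have h2 := (dvd_add_left h1).1 (ha ▸ dvd_zero _)
  have h3 : IsRelPrime (maximalMinor n j) (∏ m ∈ Finset.univ.erase j, maximalMinor n m) :=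
    IsRelPrime.prod_right fun m hm => isRelPrime_maximalMinor (Finset.ne_of_mem_erase hm).symm
  obtain ⟨c, hc⟩ := h3.dvd_of_dvd_mul_left h2
  exact ⟨c, by rw [hc, mul_comm]⟩

/-- A vector field killing every maximal minor comes from the action of `GL n`. -/
theorem exists_eq_actionField_of_forall_eq_zero (hn : n ≠ 0) {a : Fin n × Fin (n + 1) → 𝓡}
    (ha : ∀ j, mkDerivation ℂ a (maximalMinor n j) = 0) :
    ∃ B : Matrix (Fin n) (Fin n) 𝓡, B.trace = 0 ∧ a = actionField n (B, 0) := by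
  have hrow : ∀ i : Fin n, ∃ c : Fin n → 𝓡, c ᵥ* genericMatrix n = fun j => a (i, j) := by
    intro i
    have h01 : (0 : Fin (n + 1)) ≠ Fin.last n := by
      intro h
      exact hn (congrArg Fin.val h).symm
    refine exists_vecMul_eq_of_sum_signed_minors (genericMatrix n) ?_ 0 (Fin.last n)
      (maximalMinor_ne_zero _) (maximalMinor_ne_zero _) (isRelPrime_maximalMinor h01)
    have h := congrArg (mkDerivation ℂ a) (sum_signed_minors_mul_row (genericMatrix n) i)
    rw [map_sum, map_zero] at h
    rw [← h]
    refine Finset.sum_congr rfl fun j _ => ?_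
    rw [← maximalMinor_eq_det_submatrix, Derivation.leibniz, Derivation.leibniz, ha j]
    have hs : mkDerivation ℂ a ((-1) ^ (j : ℕ)) = 0 := by
      rw [Derivation.leibniz_pow]; simp
    have hX : mkDerivation ℂ a (genericMatrix n i j) = a (i, j) := mkDerivation_X _ _ _
    rw [hs, hX]
    simp only [smul_eq_mul]
    ring
  choose B hB using hrow
  have haB : a = actionField n (Matrix.of B, 0) := by
    ext1 v
    rw [← congrFun (hB v.1) v.2]
    change _ = (Matrix.of B * genericMatrix n) v.1 v.2 + genericMatrix n v.1 v.2 * 0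
    rw [mul_zero, add_zero]
    rfl
  refine ⟨Matrix.of B, ?_, haB⟩
  have h := mkDerivation_actionField_maximalMinor (Matrix.of B) 0 0
  rw [← haB, ha, eq_comm, mul_eq_zero] at h
  simpa using h.resolve_right (maximalMinor_ne_zero 0)

theorem exists_actionField_eq_of_mem_AR (hn : n ≠ 0) {a : Fin n × Fin (n + 1) → 𝓡}
    (ha : a ∈ AR (∏ j, maximalMinor n j)) :
    ∃ (B : Matrix (Fin n) (Fin n) 𝓡) (d : Fin (n + 1) → 𝓡),
      B.trace = 0 ∧ ∑ k, d k = 0 ∧ actionField n (B, d) = a := by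
  rw [AR, LinearMap.mem_ker, jacMap_eq_mkDerivation_s9] at ha
  choose h hh using exists_mkDerivation_maximalMinor_eq_mul ha
  have hsum : ∑ j, h j = 0 := by
    rw [mkDerivation_prod_maximalMinor a h hh, mul_eq_zero] at ha
    exact ha.resolve_right (Finset.prod_ne_zero_iff.2 fun j _ => maximalMinor_ne_zero j)
  have hsum' : ∑ j, (-h) j = 0 := by simp [hsum]
  have hkill : ∀ j, mkDerivation ℂ (a - actionField n (0, -h)) (maximalMinor n j) = 0 := by
    intro j
    rw [← jacMap_eq_mkDerivation_s9, map_sub, jacMap_eq_mkDerivation_s9, jacMap_eq_mkDerivation_s9, hh,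
      mkDerivation_actionField_maximalMinor, hsum']
    simp
  obtain ⟨B, hB, hBa⟩ := exists_eq_actionField_of_forall_eq_zero hn hkill
  refine ⟨B, -h, hB, hsum', ?_⟩
  have : ((B, -h) : Matrix (Fin n) (Fin n) 𝓡 × (Fin (n + 1) → 𝓡)) = (B, 0) + (0, -h) := by simp
  rw [this, map_add, ← hBa, sub_add_cancel]

end LogarithmicFields

/-- (Buchweitz–Mond) For `n ≥ 2`, the hypersurface arrangement defined by the product of
the `n+1` maximal minors of the generic `n × (n+1)` matrix of indeterminates is free. -/
theorem buchweitz_mond_free (n : ℕ) (hn : 2 ≤ n) :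
    Module.Free (MvPolynomial (Fin n × Fin (n + 1)) ℂ)
      (AR (∏ j : Fin (n + 1), maximalMinor n j)) := by
  let A := MvPolynomial (Fin n × Fin (n + 1)) ℂ
  let τ : Matrix (Fin n) (Fin n) A →ₗ[A] A := Matrix.traceLinearMap (Fin n) A A
  let s : (Fin (n + 1) → A) →ₗ[A] A := ∑ k, LinearMap.proj k
  have hs : ∀ d, s d = ∑ k, d k := fun d => by simp [s]
  let i₀ : Fin n := ⟨0, by omega⟩
  have hτ : Module.Free A (LinearMap.ker τ) :=
    LinearMap.free_ker_of_basis (Matrix.stdBasis A (Fin n) (Fin n)) τ (i₀, i₀)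
      (by rw [Matrix.stdBasis_eq_single]; exact Matrix.trace_single_eq_same i₀ (1 : A))
  have hfs : Module.Free A (LinearMap.ker s) :=
    LinearMap.free_ker_of_basis (Pi.basisFun A (Fin (n + 1))) s 0 (by simp [hs])
  let Ψ : (LinearMap.ker τ × LinearMap.ker s) →ₗ[A] AR (∏ j : Fin (n + 1), maximalMinor n j) :=
    LinearMap.codRestrict (AR (∏ j : Fin (n + 1), maximalMinor n j))
      (actionField n ∘ₗ (LinearMap.ker τ).subtype.prodMap (LinearMap.ker s).subtype)
      (fun p => actionField_mem_AR p.1.2 ((hs _).symm.trans p.2.2))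
  refine Module.Free.of_equiv (LinearEquiv.ofBijective Ψ ⟨?_, ?_⟩)
  · rw [← LinearMap.ker_eq_bot, LinearMap.ker_eq_bot']
    rintro ⟨B, d⟩ h
    obtain ⟨h1, h2⟩ := eq_zero_of_actionField_eq_zero (B := B.1) (d := d.1) B.2
      ((hs _).symm.trans d.2) (congrArg Subtype.val h)
    exact Prod.ext (Subtype.ext h1) (Subtype.ext h2)
  · rintro ⟨a, ha⟩
    obtain ⟨B, d, hB, hd, rfl⟩ := exists_actionField_eq_of_mem_AR (by omega) ha
    exact ⟨(⟨B, hB⟩, ⟨d, (hs d).trans hd⟩), rfl⟩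
end
end
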